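/- For every integer q ≥ 2, the function θ_q is well defined on [q+1, ∞), takes values in [0,1), and is a continuous, strictly increasing bijection from [q+1, ∞) onto [0,1). -/

import Mathlib

open Real Set

/-- For an integer `m ≥ 2`, the function
`F_m(φ) = -cos((m+1)φ/2) / cos((m-1)φ/2)`. -/
noncomputable def Fm (m : ℕ) (φ : ℝ) : ℝ :=
  -Real.cos (((m : ℝ) + 1) * φ / 2) / Real.cos (((m : ℝ) - 1) * φ / 2)

/-- The quantity `u(N) = ((q^{(m+1)/2} − q^{(m−1)/2})/(N − 1 − q^{(m−1)/2}) − 1)/√q`. -/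
noncomputable def uN (q m : ℕ) (N : ℝ) : ℝ :=
  (((q : ℝ) ^ (((m : ℝ) + 1) / 2) - (q : ℝ) ^ (((m : ℝ) - 1) / 2)) /
      (N - 1 - (q : ℝ) ^ (((m : ℝ) - 1) / 2)) - 1) / Real.sqrt q

/-- `θ` is the function `θ_q`: for every real `N ≥ q+1`, whenever `m ≥ 2` is the integer
with `q^{m/2} ≤ N−1 < q^{(m+1)/2}` and `φ ∈ [π/(m+1), π/m]` satisfies `F_m(φ) = u(N)`,
then `θ(N) = cos φ`. -/
def IsTheta (q : ℕ) (θ : ℝ → ℝ) : Prop :=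
  ∀ N : ℝ, (q : ℝ) + 1 ≤ N → ∀ m : ℕ, 2 ≤ m →
    (q : ℝ) ^ ((m : ℝ) / 2) ≤ N - 1 → N - 1 < (q : ℝ) ^ (((m : ℝ) + 1) / 2) →
    ∀ φ ∈ Set.Icc (π / ((m : ℝ) + 1)) (π / (m : ℝ)),
      Fm m φ = uN q m N → θ N = Real.cos φ

section Fm

variable {m : ℕ} {φ : ℝ}

lemma Fm_angle_bounds (hm : 2 ≤ m)
    (hφ : φ ∈ Icc (π / ((m : ℝ) + 1)) (π / (m : ℝ))) :
    0 < φ ∧ φ ≤ π / 2 ∧ π / 2 ≤ ((m : ℝ) + 1) * φ / 2 ∧ ((m : ℝ) + 1) * φ / 2 ≤ π ∧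
      0 ≤ ((m : ℝ) - 1) * φ / 2 ∧ ((m : ℝ) - 1) * φ / 2 < π / 2 := by
  have hm' : (2 : ℝ) ≤ m := by exact_mod_cast hm
  have hπ := Real.pi_pos
  obtain ⟨h1, h2⟩ := hφ
  have h0 : 0 < φ := lt_of_lt_of_le (by positivity) h1
  rw [div_le_iff₀ (by positivity)] at h1
  rw [le_div_iff₀ (by positivity)] at h2
  refine ⟨h0, ?_, ?_, ?_, ?_, ?_⟩ <;> nlinarith

lemma Fm_denom_pos (hm : 2 ≤ m) (hφ : φ ∈ Icc (π / ((m : ℝ) + 1)) (π / (m : ℝ))) :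
    0 < Real.cos (((m : ℝ) - 1) * φ / 2) := by
  obtain ⟨-, -, -, -, h5, h6⟩ := Fm_angle_bounds hm hφ
  exact Real.cos_pos_of_mem_Ioo ⟨by linarith [Real.pi_pos], h6⟩

lemma Fm_strictMonoOn (hm : 2 ≤ m) :
    StrictMonoOn (Fm m) (Icc (π / ((m : ℝ) + 1)) (π / (m : ℝ))) := by
  intro x hx y hy hxy
  have hm' : (2 : ℝ) ≤ m := by exact_mod_cast hm
  obtain ⟨-, -, hx3, hx4, hx5, hx6⟩ := Fm_angle_bounds hm hx
  obtain ⟨-, -, hy3, hy4, hy5, hy6⟩ := Fm_angle_bounds hm hy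
  have hπ := Real.pi_pos
  have hnum : Real.cos (((m : ℝ) + 1) * y / 2) < Real.cos (((m : ℝ) + 1) * x / 2) :=
    Real.cos_lt_cos_of_nonneg_of_le_pi (by linarith) hy4 (by nlinarith)
  have hden : Real.cos (((m : ℝ) - 1) * y / 2) ≤ Real.cos (((m : ℝ) - 1) * x / 2) :=
    Real.cos_le_cos_of_nonneg_of_le_pi hx5 (by linarith) (by nlinarith)
  have hxn : Real.cos (((m : ℝ) + 1) * x / 2) ≤ 0 :=
    Real.cos_nonpos_of_pi_div_two_le_of_le hx3 (by linarith)
  exact div_lt_div₀ (neg_lt_neg hnum) hden (by linarith) (Fm_denom_pos hm hy)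

lemma Fm_continuousOn (hm : 2 ≤ m) :
    ContinuousOn (Fm m) (Icc (π / ((m : ℝ) + 1)) (π / (m : ℝ))) := by
  unfold Fm
  exact ContinuousOn.div (by fun_prop) (by fun_prop) fun x hx => (Fm_denom_pos hm hx).ne'

lemma Fm_left (m : ℕ) : Fm m (π / ((m : ℝ) + 1)) = 0 := by
  have : ((m : ℝ) + 1) * (π / ((m : ℝ) + 1)) / 2 = π / 2 := by field_simp
  rw [Fm, this, Real.cos_pi_div_two]
  simp

lemma pi_div_mem_Icc (hm : 2 ≤ m) :
    π / ((m : ℝ) + 1) ∈ Icc (π / ((m : ℝ) + 1)) (π / (m : ℝ)) ∧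
      π / (m : ℝ) ∈ Icc (π / ((m : ℝ) + 1)) (π / (m : ℝ)) := by
  have hm' : (2 : ℝ) ≤ m := by exact_mod_cast hm
  have : π / ((m : ℝ) + 1) ≤ π / (m : ℝ) :=
    div_le_div_of_nonneg_left Real.pi_pos.le (by linarith) (by linarith)
  exact ⟨⟨le_rfl, this⟩, ⟨this, le_rfl⟩⟩

lemma Fm_right (hm : 2 ≤ m) : Fm m (π / (m : ℝ)) = 1 := by
  have hpos := Fm_denom_pos hm (pi_div_mem_Icc hm).2
  have hm' : (m : ℝ) ≠ 0 := by positivity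
  have : ((m : ℝ) + 1) * (π / (m : ℝ)) / 2 = π - ((m : ℝ) - 1) * (π / (m : ℝ)) / 2 := by
    field_simp
    ring
  rw [Fm, this, Real.cos_pi_sub, neg_neg, div_self hpos.ne']

end Fm

section uN

variable {q m : ℕ} {N : ℝ}

lemma natCast_rpow_half (q k : ℕ) : (q : ℝ) ^ ((k : ℝ) / 2) = √(q : ℝ) ^ k := by
  rw [Real.sqrt_eq_rpow, ← Real.rpow_natCast, ← Real.rpow_mul (Nat.cast_nonneg q)]
  congr 1
  ring

lemma natCast_rpow_half_succ (q k : ℕ) :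
    (q : ℝ) ^ (((k : ℝ) + 1) / 2) = √(q : ℝ) ^ (k + 1) := by
  rw [← natCast_rpow_half]
  push_cast
  rfl

lemma natCast_rpow_half_pred (q : ℕ) (hm : 2 ≤ m) :
    (q : ℝ) ^ (((m : ℝ) - 1) / 2) = √(q : ℝ) ^ (m - 1) := by
  rw [← natCast_rpow_half, Nat.cast_sub (by omega), Nat.cast_one]

lemma one_lt_sqrt_natCast (hq : 2 ≤ q) : 1 < √(q : ℝ) := by
  rw [Real.lt_sqrt zero_le_one]
  have : (2 : ℝ) ≤ q := by exact_mod_cast hq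
  linarith

/-- The quantity `uN` in terms of `s = √q` and `A = s ^ (m - 1)`. -/
lemma uN_eq (hm : 2 ≤ m) :
    uN q m N = ((√(q : ℝ) ^ (m - 1) * √(q : ℝ) ^ 2 - √(q : ℝ) ^ (m - 1)) /
      (N - 1 - √(q : ℝ) ^ (m - 1)) - 1) / √(q : ℝ) := by
  rw [uN, natCast_rpow_half_succ, natCast_rpow_half_pred q hm, ← pow_add,
    show m - 1 + 2 = m + 1 by omega]

lemma existsUnique_index (hq : 2 ≤ q) (hN : (q : ℝ) + 1 ≤ N) : ∃! m : ℕ, 2 ≤ m ∧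
    (q : ℝ) ^ ((m : ℝ) / 2) ≤ N - 1 ∧ N - 1 < (q : ℝ) ^ (((m : ℝ) + 1) / 2) := by
  have hs := one_lt_sqrt_natCast hq
  have hq' : (2 : ℝ) ≤ q := by exact_mod_cast hq
  simp only [natCast_rpow_half, natCast_rpow_half_succ]
  obtain ⟨m, h1, h2⟩ := exists_nat_pow_near (x := N - 1) (by linarith) hs
  refine ⟨m, ⟨?_, h1, h2⟩, ?_⟩
  · have h3 : √(q : ℝ) ^ 2 < √(q : ℝ) ^ (m + 1) := by
      rw [Real.sq_sqrt (by linarith)]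
      linarith
    have := (pow_lt_pow_iff_right₀ hs).1 h3
    omega
  · rintro k ⟨-, h3, h4⟩
    have h5 := (pow_lt_pow_iff_right₀ hs).1 (h1.trans_lt h4)
    have h6 := (pow_lt_pow_iff_right₀ hs).1 (h3.trans_lt h2)
    omega

lemma sub_pos_of_le (hq : 2 ≤ q) (hm : 2 ≤ m) (h1 : (q : ℝ) ^ ((m : ℝ) / 2) ≤ N - 1) :
    0 < N - 1 - √(q : ℝ) ^ (m - 1) := by
  rw [natCast_rpow_half] at h1
  have := pow_lt_pow_right₀ (one_lt_sqrt_natCast hq) (show m - 1 < m by omega)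
  linarith

lemma uN_pos (hq : 2 ≤ q) (hm : 2 ≤ m) (h1 : (q : ℝ) ^ ((m : ℝ) / 2) ≤ N - 1)
    (h2 : N - 1 < (q : ℝ) ^ (((m : ℝ) + 1) / 2)) : 0 < uN q m N := by
  have hs := one_lt_sqrt_natCast hq
  have hd := sub_pos_of_le hq hm h1
  rw [natCast_rpow_half_succ, show m + 1 = m - 1 + 2 by omega, pow_add] at h2
  rw [uN_eq hm]
  refine div_pos ?_ (by linarith)
  rw [sub_pos, one_lt_div hd]
  linarith

lemma uN_le_one (hq : 2 ≤ q) (hm : 2 ≤ m) (h1 : (q : ℝ) ^ ((m : ℝ) / 2) ≤ N - 1) :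
    uN q m N ≤ 1 := by
  have hs := one_lt_sqrt_natCast hq
  have hd := sub_pos_of_le hq hm h1
  rw [natCast_rpow_half, show m = m - 1 + 1 by omega, pow_succ] at h1
  rw [uN_eq hm, div_le_one (by linarith), sub_le_iff_le_add, div_le_iff₀ hd]
  nlinarith

lemma uN_lt_uN {N' : ℝ} (hq : 2 ≤ q) (hm : 2 ≤ m) (h1 : (q : ℝ) ^ ((m : ℝ) / 2) ≤ N - 1)
    (h : N < N') : uN q m N' < uN q m N := by
  have hs := one_lt_sqrt_natCast hq
  have hd := sub_pos_of_le hq hm h1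
  have hA : 0 < √(q : ℝ) ^ (m - 1) := by positivity
  rw [uN_eq hm, uN_eq hm]
  refine div_lt_div_of_pos_right (sub_lt_sub_right ?_ _) (by linarith)
  have hB := mul_pos hA (sub_pos.2 (one_lt_pow₀ hs two_ne_zero))
  exact div_lt_div_of_pos_left (by linarith) hd (by linarith)

lemma exists_uN_eq {t : ℝ} (hq : 2 ≤ q) (hm : 2 ≤ m) (ht : t ∈ Ioc (0 : ℝ) 1) :
    ∃ N : ℝ, (q : ℝ) ^ ((m : ℝ) / 2) ≤ N - 1 ∧ N - 1 < (q : ℝ) ^ (((m : ℝ) + 1) / 2) ∧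
      uN q m N = t := by
  obtain ⟨ht0, ht1⟩ := ht
  have hs := one_lt_sqrt_natCast hq
  have hA : 0 < √(q : ℝ) ^ (m - 1) := by positivity
  rw [natCast_rpow_half, natCast_rpow_half_succ]
  simp only [uN_eq hm]
  rw [show √(q : ℝ) ^ m = √(q : ℝ) ^ (m - 1) * √(q : ℝ) by
      rw [← pow_succ, show m - 1 + 1 = m by omega],
    show √(q : ℝ) ^ (m + 1) = √(q : ℝ) ^ (m - 1) * √(q : ℝ) ^ 2 by
      rw [← pow_add, show m - 1 + 2 = m + 1 by omega]]
  generalize √(q : ℝ) ^ (m - 1) = A at hA ⊢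
  generalize √(q : ℝ) = s at hs ⊢
  have hst : 0 < s * t := by positivity
  have hB : 0 < A * s ^ 2 - A := by
    have := mul_pos hA (sub_pos.2 (one_lt_pow₀ hs two_ne_zero))
    linarith
  refine ⟨1 + A + (A * s ^ 2 - A) / (1 + s * t), ?_, ?_, ?_⟩
  · have : A * s - A ≤ (A * s ^ 2 - A) / (1 + s * t) := by
      rw [le_div_iff₀ (by positivity)]
      nlinarith [mul_nonneg (mul_nonneg hA.le (sub_nonneg.2 hs.le))
        (mul_nonneg (zero_le_one.trans hs.le) (sub_nonneg.2 ht1))]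
    linarith
  · have : (A * s ^ 2 - A) / (1 + s * t) < A * s ^ 2 - A :=
      div_lt_self hB (by linarith)
    linarith
  · have h1 : 1 + A + (A * s ^ 2 - A) / (1 + s * t) - 1 - A = (A * s ^ 2 - A) / (1 + s * t) := by
      ring
    rw [h1, div_div_cancel₀ hB.ne']
    field_simp
    ring

end uN

/-- The data entering the definition of `θ_q(N)`: the index `m` and the angle `φ`. -/
structure IsThetaAngle (q : ℕ) (N : ℝ) (m : ℕ) (φ : ℝ) : Prop where
  two_le : 2 ≤ m
  le : (q : ℝ) ^ ((m : ℝ) / 2) ≤ N - 1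
  lt : N - 1 < (q : ℝ) ^ (((m : ℝ) + 1) / 2)
  mem : φ ∈ Icc (π / ((m : ℝ) + 1)) (π / (m : ℝ))
  eq : Fm m φ = uN q m N

section IsThetaAngle

variable {q m m' : ℕ} {N N' φ φ' : ℝ}

lemma exists_Fm_eq_uN (hq : 2 ≤ q) (hm : 2 ≤ m) (h1 : (q : ℝ) ^ ((m : ℝ) / 2) ≤ N - 1)
    (h2 : N - 1 < (q : ℝ) ^ (((m : ℝ) + 1) / 2)) :
    ∃ φ ∈ Icc (π / ((m : ℝ) + 1)) (π / (m : ℝ)), Fm m φ = uN q m N := by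
  refine intermediate_value_Icc (pi_div_mem_Icc hm).1.2 (Fm_continuousOn hm) ?_
  rw [Fm_left, Fm_right hm]
  exact ⟨(uN_pos hq hm h1 h2).le, uN_le_one hq hm h1⟩

lemma exists_isThetaAngle (hq : 2 ≤ q) (hN : (q : ℝ) + 1 ≤ N) :
    ∃ m φ, IsThetaAngle q N m φ := by
  obtain ⟨m, ⟨hm, h1, h2⟩, -⟩ := existsUnique_index hq hN
  obtain ⟨φ, h3, h4⟩ := exists_Fm_eq_uN hq hm h1 h2
  exact ⟨m, φ, hm, h1, h2, h3, h4⟩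

namespace IsThetaAngle

lemma add_one_le (hq : 2 ≤ q) (h : IsThetaAngle q N m φ) : (q : ℝ) + 1 ≤ N := by
  have h1 := h.le
  rw [natCast_rpow_half] at h1
  have h2 := pow_le_pow_right₀ (one_lt_sqrt_natCast hq).le h.two_le
  rw [Real.sq_sqrt (Nat.cast_nonneg q)] at h2
  linarith

lemma index_le (hq : 2 ≤ q) (h : IsThetaAngle q N m φ) (h' : IsThetaAngle q N' m' φ')
    (hN : N ≤ N') : m ≤ m' := by
  have h1 := h.le
  have h2 := h'.lt
  rw [natCast_rpow_half] at h1
  rw [natCast_rpow_half_succ] at h2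
  have := (pow_lt_pow_iff_right₀ (one_lt_sqrt_natCast hq)).1
    (show √(q : ℝ) ^ m < √(q : ℝ) ^ (m' + 1) by linarith)
  omega

lemma left_lt (hq : 2 ≤ q) (h : IsThetaAngle q N m φ) : π / ((m : ℝ) + 1) < φ := by
  rw [← (Fm_strictMonoOn h.two_le).lt_iff_lt (pi_div_mem_Icc h.two_le).1 h.mem, Fm_left, h.eq]
  exact uN_pos hq h.two_le h.le h.lt

lemma angle_lt (hq : 2 ≤ q) (h : IsThetaAngle q N m φ) (h' : IsThetaAngle q N' m' φ')
    (hN : N < N') : φ' < φ := by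
  rcases (index_le hq h h' hN.le).eq_or_lt with rfl | hlt
  · rw [← (Fm_strictMonoOn h.two_le).lt_iff_lt h'.mem h.mem, h.eq, h'.eq]
    exact uN_lt_uN hq h.two_le h.le hN
  · have hle : (m : ℝ) + 1 ≤ m' := by exact_mod_cast hlt
    calc φ' ≤ π / (m' : ℝ) := h'.mem.2
      _ ≤ π / ((m : ℝ) + 1) :=
        div_le_div_of_nonneg_left Real.pi_pos.le (by positivity) hle
      _ < φ := h.left_lt hq

lemma angle_unique (hq : 2 ≤ q) (h : IsThetaAngle q N m φ) (h' : IsThetaAngle q N m' φ') :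
    φ = φ' := by
  obtain rfl : m = m' := le_antisymm (index_le hq h h' le_rfl) (index_le hq h' h le_rfl)
  exact (Fm_strictMonoOn h.two_le).injOn h.mem h'.mem (h.eq.trans h'.eq.symm)

lemma cos_lt_cos (hq : 2 ≤ q) (h : IsThetaAngle q N m φ) (h' : IsThetaAngle q N' m' φ')
    (hN : N < N') : Real.cos φ < Real.cos φ' := by
  have h1 := Fm_angle_bounds h.two_le h.mem
  have h2 := Fm_angle_bounds h'.two_le h'.mem
  exact Real.cos_lt_cos_of_nonneg_of_le_pi h2.1.le (by linarith [Real.pi_pos])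
    (angle_lt hq h h' hN)

lemma cos_mem (h : IsThetaAngle q N m φ) : Real.cos φ ∈ Ico (0 : ℝ) 1 := by
  obtain ⟨h1, h2, -⟩ := Fm_angle_bounds h.two_le h.mem
  refine ⟨Real.cos_nonneg_of_mem_Icc ⟨by linarith, h2⟩, ?_⟩
  have := Real.cos_lt_cos_of_nonneg_of_le_pi le_rfl (by linarith [Real.pi_pos]) h1
  rwa [Real.cos_zero] at this

lemma exists_of_angle (hq : 2 ≤ q) (h0 : 0 < φ) (h1 : φ ≤ π / 2) :
    ∃ N m, IsThetaAngle q N m φ := by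
  have hπ := Real.pi_pos
  have hm : 2 ≤ ⌊π / φ⌋₊ := by
    rw [Nat.le_floor_iff (by positivity), le_div_iff₀ h0]
    push_cast
    linarith
  have ha := Nat.floor_le (show 0 ≤ π / φ by positivity)
  have hb := Nat.lt_floor_add_one (π / φ)
  generalize ⌊π / φ⌋₊ = m at hm ha hb
  have hm' : (2 : ℝ) ≤ m := by exact_mod_cast hm
  rw [le_div_iff₀ h0] at ha
  rw [div_lt_iff₀ h0] at hb
  have hl : π / ((m : ℝ) + 1) < φ := by
    rw [div_lt_iff₀ (by positivity)]
    linarith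
  have hr : φ ≤ π / (m : ℝ) := by
    rw [le_div_iff₀ (by positivity)]
    linarith
  have hmem : φ ∈ Icc (π / ((m : ℝ) + 1)) (π / (m : ℝ)) := ⟨hl.le, hr⟩
  have hF : Fm m φ ∈ Ioc (0 : ℝ) 1 := by
    constructor
    · rw [← Fm_left m]
      exact Fm_strictMonoOn hm (pi_div_mem_Icc hm).1 hmem hl
    · rw [← Fm_right hm]
      exact (Fm_strictMonoOn hm).monotoneOn hmem (pi_div_mem_Icc hm).2 hr
  obtain ⟨N, h2, h3, h4⟩ := exists_uN_eq hq hm hF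
  exact ⟨N, m, hm, h2, h3, hmem, h4.symm⟩

end IsThetaAngle

end IsThetaAngle

/-- A strictly monotone function mapping an order-connected set onto an order-connected set is
continuous there. -/
lemma StrictMonoOn.continuousOn_of_bijOn {f : ℝ → ℝ} {s t : Set ℝ} [s.OrdConnected]
    [ht : t.OrdConnected] (hf : StrictMonoOn f s) (hst : BijOn f s t) : ContinuousOn f s := by
  obtain rfl := hst.image_eq
  rw [continuousOn_iff_continuous_domRestrict]
  exact continuous_subtype_val.comp (hf.orderIso f s).continuous

/-- For every integer `q ≥ 2`, the function `θ_q` is well defined on `[q+1, ∞)`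
(for each `N ≥ q+1` there is a unique integer `m ≥ 2` with `q^{m/2} ≤ N−1 < q^{(m+1)/2}`,
and a suitable `φ` exists), takes values in `[0,1)`, and is a continuous, strictly
increasing bijection from `[q+1, ∞)` onto `[0,1)`. -/
theorem stmt_1 (q : ℕ) (hq : 2 ≤ q) :
    (∀ N : ℝ, (q : ℝ) + 1 ≤ N → ∃! m : ℕ, 2 ≤ m ∧
      (q : ℝ) ^ ((m : ℝ) / 2) ≤ N - 1 ∧ N - 1 < (q : ℝ) ^ (((m : ℝ) + 1) / 2)) ∧
    (∀ N : ℝ, (q : ℝ) + 1 ≤ N → ∀ m : ℕ, 2 ≤ m →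
      (q : ℝ) ^ ((m : ℝ) / 2) ≤ N - 1 → N - 1 < (q : ℝ) ^ (((m : ℝ) + 1) / 2) →
      ∃ φ ∈ Set.Icc (π / ((m : ℝ) + 1)) (π / (m : ℝ)), Fm m φ = uN q m N) ∧
    ∃ θ : ℝ → ℝ, IsTheta q θ ∧
      Set.MapsTo θ (Set.Ici ((q : ℝ) + 1)) (Set.Ico 0 1) ∧
      ContinuousOn θ (Set.Ici ((q : ℝ) + 1)) ∧
      StrictMonoOn θ (Set.Ici ((q : ℝ) + 1)) ∧
      Set.BijOn θ (Set.Ici ((q : ℝ) + 1)) (Set.Ico 0 1) := by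
  have hex : ∀ N : ℝ, ∃ y : ℝ, (q : ℝ) + 1 ≤ N → ∃ m φ, IsThetaAngle q N m φ ∧ y = Real.cos φ := by
    intro N
    by_cases hN : (q : ℝ) + 1 ≤ N
    · obtain ⟨m, φ, h⟩ := exists_isThetaAngle hq hN
      exact ⟨Real.cos φ, fun _ => ⟨m, φ, h, rfl⟩⟩
    · exact ⟨0, fun h => absurd h hN⟩
  choose θ hθ using hex
  have hmaps : MapsTo θ (Ici ((q : ℝ) + 1)) (Ico 0 1) := by
    intro N hN
    obtain ⟨m, φ, h, hc⟩ := hθ N hN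
    exact hc ▸ h.cos_mem
  have hmono : StrictMonoOn θ (Ici ((q : ℝ) + 1)) := by
    intro N hN N' hN' hlt
    obtain ⟨m, φ, h, hc⟩ := hθ N hN
    obtain ⟨m', φ', h', hc'⟩ := hθ N' hN'
    rw [hc, hc']
    exact h.cos_lt_cos hq h' hlt
  have hsurj : SurjOn θ (Ici ((q : ℝ) + 1)) (Ico 0 1) := by
    rintro y ⟨hy0, hy1⟩
    obtain ⟨N, m, h⟩ := IsThetaAngle.exists_of_angle hq (Real.arccos_pos.2 hy1)
      (Real.arccos_le_pi_div_two.2 hy0)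
    have hN := h.add_one_le hq
    refine ⟨N, hN, ?_⟩
    obtain ⟨m', φ', h', hc⟩ := hθ N hN
    rw [hc, ← h.angle_unique hq h', Real.cos_arccos (by linarith) hy1.le]
  have hbij : BijOn θ (Ici ((q : ℝ) + 1)) (Ico 0 1) := ⟨hmaps, hmono.injOn, hsurj⟩
  refine ⟨fun N hN => existsUnique_index hq hN, fun N _ m hm h1 h2 => exists_Fm_eq_uN hq hm h1 h2,
    θ, ?_, hmaps, hmono.continuousOn_of_bijOn hbij, hmono, hbij⟩
  intro N hN m hm h1 h2 φ hφ he
  obtain ⟨m', φ', h', hc⟩ := hθ N hN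
  rw [hc, h'.angle_unique hq ⟨hm, h1, h2, hφ, he⟩]
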